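/- arXiv:math-ph/0205044 — 6 statements merged into one kernel-verified Lean document; each statement's English description precedes it below -/
import Mathlib

section
/- For every e > 0, the function k ↦ e·k⁵ / ( (k² + k)(e + k² + k) ) · ( 1/k⁴ + 1/(k² + k)² ) is Lebesgue integrable on (0, ∞); moreover the map Λ ↦ f(0, Λ) − f(e, Λ) is nondecreasing in Λ and converges, as Λ → ∞, to S(e) = (4/(3π)) ∫₀^∞ e·k⁵ / ( (k² + k)(e + k² + k) ) · ( 1/k⁴ + 1/(k² + k)² ) dk. -/
open MeasureTheory Real Filter

/-- `f(e, Λ) = (4/(3π)) ∫₀^Λ k⁵/(e + k² + k) · (1/k⁴ + 1/(k² + k)²) dk`, the one-photon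
contribution to the binding energy in the Pauli–Fierz model. -/
noncomputable def bindingF (e Λ : ℝ) : ℝ :=
  (4 / (3 * π)) * ∫ k in Set.Ioo (0 : ℝ) Λ,
    (k ^ 5 / (e + k ^ 2 + k)) * (1 / k ^ 4 + 1 / (k ^ 2 + k) ^ 2)

/-- `S(e) = (4/(3π)) ∫₀^∞ e k⁵/((k² + k)(e + k² + k)) · (1/k⁴ + 1/(k² + k)²) dk`, the
cut-off-free, mass-renormalized energy level shift in the Pauli–Fierz model. -/
noncomputable def bindingS (e : ℝ) : ℝ :=
  (4 / (3 * π)) * ∫ k in Set.Ioi (0 : ℝ),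
    e * k ^ 5 / ((k ^ 2 + k) * (e + k ^ 2 + k)) * (1 / k ^ 4 + 1 / (k ^ 2 + k) ^ 2)

/-- The photon weight is at most `2 / k⁴`. -/
lemma photon_weight_le {k : ℝ} (hk : 0 < k) :
    1 / k ^ 4 + 1 / (k ^ 2 + k) ^ 2 ≤ 2 / k ^ 4 := by
  have h : 1 / (k ^ 2 + k) ^ 2 ≤ 1 / k ^ 4 := by
    apply one_div_le_one_div_of_le (by positivity)
    nlinarith [pow_pos hk 3, pow_pos hk 2]
  calc 1 / k ^ 4 + 1 / (k ^ 2 + k) ^ 2 ≤ 1 / k ^ 4 + 1 / k ^ 4 := by gcongr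
    _ = 2 / k ^ 4 := by ring

/-- The integrand of `bindingF` is bounded by `2`. -/
lemma bindingF_integrand_le_two {e k : ℝ} (he : 0 ≤ e) (hk : 0 < k) :
    (k ^ 5 / (e + k ^ 2 + k)) * (1 / k ^ 4 + 1 / (k ^ 2 + k) ^ 2) ≤ 2 := by
  calc (k ^ 5 / (e + k ^ 2 + k)) * (1 / k ^ 4 + 1 / (k ^ 2 + k) ^ 2)
      ≤ (k ^ 5 / k) * (2 / k ^ 4) := by
        gcongr
        · nlinarith [sq_nonneg k]
        · exact photon_weight_le hk
    _ = 2 := by field_simp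

lemma integrableOn_bindingF_integrand {e : ℝ} (he : 0 ≤ e) (Λ : ℝ) :
    IntegrableOn (fun k : ℝ => (k ^ 5 / (e + k ^ 2 + k)) * (1 / k ^ 4 + 1 / (k ^ 2 + k) ^ 2))
      (Set.Ioo 0 Λ) := by
  refine Measure.integrableOn_of_bounded (M := 2) (by simp) ?_ ?_
  · exact Measurable.aestronglyMeasurable (by fun_prop)
  · filter_upwards [ae_restrict_mem measurableSet_Ioo] with k hk
    have hk0 : 0 < k := hk.1
    rw [Real.norm_of_nonneg (by positivity)]
    exact bindingF_integrand_le_two he hk0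

lemma bindingS_integrand_eq_sub {e k : ℝ} (he : 0 ≤ e) (hk : 0 < k) :
    e * k ^ 5 / ((k ^ 2 + k) * (e + k ^ 2 + k)) * (1 / k ^ 4 + 1 / (k ^ 2 + k) ^ 2) =
      (k ^ 5 / (0 + k ^ 2 + k)) * (1 / k ^ 4 + 1 / (k ^ 2 + k) ^ 2) -
        (k ^ 5 / (e + k ^ 2 + k)) * (1 / k ^ 4 + 1 / (k ^ 2 + k) ^ 2) := by
  have h₀ : k ^ 2 + k ≠ 0 := by positivity
  have h₁ : e + k ^ 2 + k ≠ 0 := by positivity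
  rw [← sub_mul, zero_add, div_sub_div _ _ h₀ h₁]
  ring

lemma bindingS_integrand_le {e k : ℝ} (he : 0 ≤ e) (hk : 0 < k) :
    e * k ^ 5 / ((k ^ 2 + k) * (e + k ^ 2 + k)) * (1 / k ^ 4 + 1 / (k ^ 2 + k) ^ 2) ≤
      2 * (1 + e) * (1 + k ^ 2)⁻¹ := by
  calc e * k ^ 5 / ((k ^ 2 + k) * (e + k ^ 2 + k)) * (1 / k ^ 4 + 1 / (k ^ 2 + k) ^ 2)
      ≤ e * k ^ 5 / ((k ^ 2 + k) * (e + k ^ 2 + k)) * (2 / k ^ 4) := by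
        gcongr
        exact photon_weight_le hk
    _ = 2 * e / ((1 + k) * (e + k ^ 2 + k)) := by
        field_simp
        ring
    _ ≤ 2 * (1 + e) / (1 + k ^ 2) := by
        rw [div_le_div_iff₀ (by positivity) (by positivity)]
        have h : e + k ^ 2 ≤ (1 + k) * (e + k ^ 2 + k) := by
          nlinarith [mul_nonneg he hk.le, pow_pos hk 3, pow_pos hk 2]
        nlinarith [mul_le_mul_of_nonneg_left h (by positivity : 0 ≤ 2 * (1 + e)),
          sq_nonneg k, sq_nonneg e]
    _ = 2 * (1 + e) * (1 + k ^ 2)⁻¹ := div_eq_mul_inv _ _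

lemma integrableOn_bindingS_integrand {e : ℝ} (he : 0 ≤ e) :
    IntegrableOn (fun k : ℝ =>
      e * k ^ 5 / ((k ^ 2 + k) * (e + k ^ 2 + k)) * (1 / k ^ 4 + 1 / (k ^ 2 + k) ^ 2))
      (Set.Ioi 0) := by
  refine ((integrable_inv_one_add_sq.const_mul (2 * (1 + e))).integrableOn).mono' ?_ ?_
  · exact Measurable.aestronglyMeasurable (by fun_prop)
  · filter_upwards [ae_restrict_mem measurableSet_Ioi] with k hk
    have hk0 : 0 < k := hk
    rw [Real.norm_of_nonneg (by positivity)]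
    exact bindingS_integrand_le he hk0

lemma bindingF_zero_sub {e : ℝ} (he : 0 ≤ e) (Λ : ℝ) :
    bindingF 0 Λ - bindingF e Λ = (4 / (3 * π)) * ∫ k in Set.Ioo (0 : ℝ) Λ,
      e * k ^ 5 / ((k ^ 2 + k) * (e + k ^ 2 + k)) * (1 / k ^ 4 + 1 / (k ^ 2 + k) ^ 2) := by
  rw [bindingF, bindingF, ← mul_sub, ← integral_sub
    (integrableOn_bindingF_integrand le_rfl Λ) (integrableOn_bindingF_integrand he Λ)]
  congr 1
  exact setIntegral_congr_fun measurableSet_Ioo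
    fun k hk => (bindingS_integrand_eq_sub he hk.1).symm

/-- The renormalized level shift integrand is integrable on `(0, ∞)`, and
`f(0, Λ) − f(e, Λ)` increases to `S(e)` as `Λ → ∞`. -/
theorem f_diff_tendsto_S (e : ℝ) (he : 0 < e) :
    IntegrableOn (fun k : ℝ =>
      e * k ^ 5 / ((k ^ 2 + k) * (e + k ^ 2 + k)) * (1 / k ^ 4 + 1 / (k ^ 2 + k) ^ 2))
      (Set.Ioi 0) volume ∧
    MonotoneOn (fun Λ => bindingF 0 Λ - bindingF e Λ) (Set.Ioi 0) ∧
    Tendsto (fun Λ => bindingF 0 Λ - bindingF e Λ) atTop (nhds (bindingS e)) := by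
  have hint := integrableOn_bindingS_integrand he.le
  simp only [bindingF_zero_sub he.le]
  refine ⟨hint, fun a _ b _ hab => ?_, ?_⟩
  · refine mul_le_mul_of_nonneg_left ?_ (by positivity)
    refine setIntegral_mono_set (hint.mono_set Set.Ioo_subset_Ioi_self) ?_
      (Set.Ioo_subset_Ioo_right hab).eventuallyLE
    filter_upwards [ae_restrict_mem measurableSet_Ioo] with k hk
    have hk0 : 0 < k := hk.1
    simp only [Pi.zero_apply]
    positivity
  · refine Tendsto.const_mul _ ?_
    refine (intervalIntegral_tendsto_integral_Ioi 0 hint tendsto_id).congr' ?_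
    filter_upwards [eventually_ge_atTop 0] with Λ hΛ
    rw [id, intervalIntegral.integral_of_le hΛ, integral_Ioc_eq_integral_Ioo]
end

section
/- The function S is concave on (0, ∞): for all e₁, e₂ > 0 and all t ∈ [0, 1], S(t·e₁ + (1−t)·e₂) ≥ t·S(e₁) + (1−t)·S(e₂). -/
open MeasureTheory Real

/-- The integrand of `bindingS`. -/
noncomputable def bindingIntegrand (e k : ℝ) : ℝ :=
  e * k ^ 5 / ((k ^ 2 + k) * (e + k ^ 2 + k)) * (1 / k ^ 4 + 1 / (k ^ 2 + k) ^ 2)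

/-- The factor of the integrand of `bindingS` that does not depend on `e`. -/
noncomputable def bindingWeight (k : ℝ) : ℝ :=
  (1 + k ^ 2 / (k + 1) ^ 2) / (k + 1)

lemma bindingWeight_nonneg {k : ℝ} (hk : 0 < k) : 0 ≤ bindingWeight k := by
  unfold bindingWeight
  positivity

lemma bindingWeight_le_two {k : ℝ} (hk : 0 < k) : bindingWeight k ≤ 2 := by
  unfold bindingWeight
  have h : k ^ 2 / (k + 1) ^ 2 ≤ 1 := by
    rw [div_le_one (by positivity)]
    nlinarith
  rw [div_le_iff₀ (by positivity)]
  linarith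

lemma bindingIntegrand_eq {e k : ℝ} (he : 0 < e) (hk : 0 < k) :
    bindingIntegrand e k = bindingWeight k * (e / (e + (k ^ 2 + k))) := by
  unfold bindingIntegrand bindingWeight
  have h₁ : k ^ 2 + k = k * (k + 1) := by ring
  have h₂ : e + k * (k + 1) ≠ 0 := by positivity
  rw [add_assoc e, h₁]
  field_simp

lemma bindingIntegrand_integrableOn {e : ℝ} (he : 0 < e) :
    IntegrableOn (bindingIntegrand e) (Set.Ioi 0) := by
  have hbound : IntegrableOn (fun k : ℝ => 2 * (e + 1) * (1 + k ^ 2)⁻¹) (Set.Ioi 0) :=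
    (integrable_inv_one_add_sq.const_mul _).integrableOn
  refine Integrable.mono' hbound ?_ ?_
  · unfold bindingIntegrand
    exact Measurable.aestronglyMeasurable (by fun_prop)
  · filter_upwards [ae_restrict_mem measurableSet_Ioi] with k (hk : 0 < k)
    have hw := bindingWeight_nonneg hk
    have hfrac : e / (e + (k ^ 2 + k)) ≤ (e + 1) * (1 + k ^ 2)⁻¹ := by
      rw [← div_eq_mul_inv, div_le_div_iff₀ (by positivity) (by positivity)]
      nlinarith [mul_pos he hk, sq_nonneg k, sq_nonneg e]
    rw [bindingIntegrand_eq he hk, Real.norm_of_nonneg (by positivity), mul_assoc]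
    exact mul_le_mul (bindingWeight_le_two hk) hfrac (by positivity) (by norm_num)

/-- The map `x ↦ x / (x + a)` lies below its tangent lines on `(0, ∞)`. -/
lemma div_add_le_tangent {a x m : ℝ} (ha : 0 < a) (hx : 0 < x) (hm : 0 < m) :
    x / (x + a) ≤ m / (m + a) + a / (m + a) ^ 2 * (x - m) := by
  have h : m / (m + a) + a / (m + a) ^ 2 * (x - m) - x / (x + a)
      = a * (x - m) ^ 2 / ((m + a) ^ 2 * (x + a)) := by
    field_simp
    ring
  have : 0 ≤ a * (x - m) ^ 2 / ((m + a) ^ 2 * (x + a)) := by positivity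
  linarith

lemma concaveOn_div_add {a : ℝ} (ha : 0 < a) :
    ConcaveOn ℝ (Set.Ioi 0) fun x : ℝ => x / (x + a) := by
  refine ⟨convex_Ioi 0, fun x hx y hy s t hs ht hst => ?_⟩
  have hm : 0 < s * x + t * y := convex_Ioi (0 : ℝ) hx hy hs ht hst
  have h₁ := mul_le_mul_of_nonneg_left (div_add_le_tangent ha hx hm) hs
  have h₂ := mul_le_mul_of_nonneg_left (div_add_le_tangent ha hy hm) ht
  simp only [smul_eq_mul]
  obtain rfl : t = 1 - s := by linarith
  linear_combination h₁ + h₂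

lemma concaveOn_bindingIntegrand {k : ℝ} (hk : 0 < k) :
    ConcaveOn ℝ (Set.Ioi 0) fun e => bindingIntegrand e k := by
  have h : ConcaveOn ℝ (Set.Ioi 0) fun e : ℝ => bindingWeight k * (e / (e + (k ^ 2 + k))) :=
    (concaveOn_div_add (by positivity)).smul (bindingWeight_nonneg hk)
  exact h.congr fun e he => (bindingIntegrand_eq he hk).symm

/-- The function `S` is concave on `(0, ∞)`. -/
theorem bindingS_concave (e₁ e₂ : ℝ) (h₁ : 0 < e₁) (h₂ : 0 < e₂) (t : ℝ)
    (ht₀ : 0 ≤ t) (ht₁ : t ≤ 1) :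
    t * bindingS e₁ + (1 - t) * bindingS e₂ ≤ bindingS (t * e₁ + (1 - t) * e₂) := by
  have hm : 0 < t * e₁ + (1 - t) * e₂ :=
    convex_Ioi (0 : ℝ) h₁ h₂ ht₀ (sub_nonneg.2 ht₁) (add_sub_cancel t 1)
  have hi₁ := (bindingIntegrand_integrableOn h₁).const_mul t
  have hi₂ := (bindingIntegrand_integrableOn h₂).const_mul (1 - t)
  have key : t * (∫ k in Set.Ioi (0 : ℝ), bindingIntegrand e₁ k)
      + (1 - t) * (∫ k in Set.Ioi (0 : ℝ), bindingIntegrand e₂ k)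
      ≤ ∫ k in Set.Ioi (0 : ℝ), bindingIntegrand (t * e₁ + (1 - t) * e₂) k := by
    rw [← integral_const_mul, ← integral_const_mul, ← integral_add hi₁ hi₂]
    exact setIntegral_mono_on (hi₁.add hi₂) (bindingIntegrand_integrableOn hm) measurableSet_Ioi
      fun k hk => (concaveOn_bindingIntegrand hk).2 h₁ h₂ ht₀ (sub_nonneg.2 ht₁)
        (add_sub_cancel t 1)
  have hc : 0 ≤ 4 / (3 * π) := by positivity
  have := mul_le_mul_of_nonneg_left key hc
  simp only [bindingIntegrand] at this
  unfold bindingS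
  linarith
end

section
/- As e → 0⁺, S(e) is asymptotic to (4/(3π)) · e · ln(1/e); that is, the limit of S(e) / ( e · ln(1/e) ) as e tends to 0 from the right equals 4/(3π). -/
open MeasureTheory Real Filter

/-- The error term `1/(1 + k)²` is integrable on `(0, ∞)`. -/
lemma integrableOn_one_div_one_add_sq :
    IntegrableOn (fun k : ℝ => 1 / (1 + k) ^ 2) (Set.Ioi 0) := by
  have hderiv : ∀ k ∈ Set.Ici (0 : ℝ),
      HasDerivAt (fun k : ℝ => -(1 + k)⁻¹) (1 / (1 + k) ^ 2) k := by
    intro k hk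
    have hk : (0 : ℝ) ≤ k := hk
    have h := (((hasDerivAt_id k).const_add 1).inv (by simp; positivity)).neg
    exact h.congr_deriv (by simp [neg_div])
  have hlim : Tendsto (fun k : ℝ => -(1 + k)⁻¹) atTop (nhds (-0)) :=
    (tendsto_inv_atTop_zero.comp (tendsto_atTop_add_const_left _ 1 tendsto_id)).neg
  exact integrableOn_Ioi_deriv_of_nonneg' hderiv (fun k _ => by positivity) hlim

/-- The comparison kernel `1/((e + k)(1 + k))` is integrable on `(0, ∞)`, with an explicit
integral. -/
lemma integral_Ioi_one_div_add_mul_one_add {e : ℝ} (he : 0 < e) (he1 : e < 1) :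
    IntegrableOn (fun k : ℝ => 1 / ((e + k) * (1 + k))) (Set.Ioi 0) ∧
      ∫ k in Set.Ioi (0 : ℝ), 1 / ((e + k) * (1 + k)) = Real.log (1 / e) / (1 - e) := by
  have hne : 1 - e ≠ 0 := by linarith
  have hderiv : ∀ k ∈ Set.Ici (0 : ℝ),
      HasDerivAt (fun k : ℝ => Real.log ((e + k) / (1 + k)) / (1 - e))
        (1 / ((e + k) * (1 + k))) k := by
    intro k hk
    have hk : (0 : ℝ) ≤ k := hk
    have h1 : 1 + k ≠ 0 := by positivity
    have h2 : e + k ≠ 0 := by positivity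
    have h := ((((hasDerivAt_id' k).const_add e).div ((hasDerivAt_id' k).const_add 1) h1).log
      (div_ne_zero h2 h1)).div_const (1 - e)
    refine h.congr_deriv ?_
    simp only [Pi.div_apply]
    field_simp
    ring
  have hnonneg : ∀ k ∈ Set.Ioi (0 : ℝ), 0 ≤ 1 / ((e + k) * (1 + k)) := by
    intro k hk
    have hk : (0 : ℝ) < k := hk
    positivity
  have hratio : Tendsto (fun k : ℝ => (e + k) / (1 + k)) atTop (nhds 1) := by
    have h : Tendsto (fun k : ℝ => 1 + (e - 1) * (1 + k)⁻¹) atTop (nhds (1 + (e - 1) * 0)) :=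
      ((tendsto_inv_atTop_zero.comp
        (tendsto_atTop_add_const_left _ 1 tendsto_id)).const_mul _).const_add _
    rw [mul_zero, add_zero] at h
    refine h.congr' ?_
    filter_upwards [eventually_gt_atTop 0] with k hk
    field_simp
    ring
  have hlim : Tendsto (fun k : ℝ => Real.log ((e + k) / (1 + k)) / (1 - e)) atTop (nhds 0) := by
    simpa using (hratio.log one_ne_zero).div_const (1 - e)
  refine ⟨integrableOn_Ioi_deriv_of_nonneg' hderiv hnonneg hlim, ?_⟩
  rw [integral_Ioi_of_hasDerivAt_of_nonneg' hderiv hnonneg hlim]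
  simp
  ring

/-- The integrand of `bindingS`, divided by `e`, differs from `1/((e + k)(1 + k))` by at most
`1/(1 + k)²`. -/
lemma abs_bindingS_kernel_sub_le {e k : ℝ} (he : 0 < e) (hk : 0 < k) :
    |k ^ 5 / ((k ^ 2 + k) * (e + k ^ 2 + k)) * (1 / k ^ 4 + 1 / (k ^ 2 + k) ^ 2)
      - 1 / ((e + k) * (1 + k))| ≤ 1 / (1 + k) ^ 2 := by
  have hsplit : k ^ 5 / ((k ^ 2 + k) * (e + k ^ 2 + k)) * (1 / k ^ 4 + 1 / (k ^ 2 + k) ^ 2)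
      - 1 / ((e + k) * (1 + k))
      = k ^ 2 / ((1 + k) ^ 3 * (e + k ^ 2 + k))
        - k ^ 2 / ((1 + k) * (e + k) * (e + k ^ 2 + k)) := by
    have h : k ^ 2 + k = k * (1 + k) := by ring
    rw [add_assoc e, h]
    field_simp
    ring
  have hfst : k ^ 2 / ((1 + k) ^ 3 * (e + k ^ 2 + k)) ≤ 1 / (1 + k) ^ 2 := by
    rw [div_le_div_iff₀ (by positivity) (by positivity), one_mul, pow_succ (1 + k) 2,
      mul_comm (k ^ 2), mul_assoc]
    gcongr
    nlinarith [mul_pos he hk, mul_pos (pow_pos hk 2) hk, pow_pos hk 2]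
  have hsnd : k ^ 2 / ((1 + k) * (e + k) * (e + k ^ 2 + k)) ≤ 1 / (1 + k) ^ 2 := by
    calc k ^ 2 / ((1 + k) * (e + k) * (e + k ^ 2 + k))
        ≤ k ^ 2 / ((1 + k) * (0 + k) * (0 + k ^ 2 + k)) := by gcongr
      _ = 1 / (1 + k) ^ 2 := by
        field_simp
        ring
  have hfst0 : 0 ≤ k ^ 2 / ((1 + k) ^ 3 * (e + k ^ 2 + k)) := by positivity
  have hsnd0 : 0 ≤ k ^ 2 / ((1 + k) * (e + k) * (e + k ^ 2 + k)) := by positivity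
  rw [hsplit, abs_le]
  constructor <;> linarith

/-- `S(e) = (4/(3π)) e (ln(1/e)/(1 - e) + O(1))` on `(0, 1)`. -/
lemma exists_bindingS_eq_log_add_bounded :
    ∃ C : ℝ, ∀ e : ℝ, 0 < e → e < 1 → ∃ r : ℝ, |r| ≤ C ∧
      bindingS e = 4 / (3 * π) * (e * (Real.log (1 / e) / (1 - e) + r)) := by
  refine ⟨∫ k in Set.Ioi (0 : ℝ), 1 / (1 + k) ^ 2, fun e he he1 => ?_⟩
  obtain ⟨hint, hval⟩ := integral_Ioi_one_div_add_mul_one_add he he1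
  set g : ℝ → ℝ := fun k =>
    k ^ 5 / ((k ^ 2 + k) * (e + k ^ 2 + k)) * (1 / k ^ 4 + 1 / (k ^ 2 + k) ^ 2) with hg
  have hbound : ∀ᵐ k ∂volume.restrict (Set.Ioi (0 : ℝ)),
      ‖g k - 1 / ((e + k) * (1 + k))‖ ≤ 1 / (1 + k) ^ 2 := by
    filter_upwards [ae_restrict_mem measurableSet_Ioi] with k hk
    exact abs_bindingS_kernel_sub_le he hk
  have hmeas : Measurable fun k => g k - 1 / ((e + k) * (1 + k)) := by
    fun_prop
  have hdiff : IntegrableOn (fun k => g k - 1 / ((e + k) * (1 + k))) (Set.Ioi 0) :=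
    Integrable.mono' integrableOn_one_div_one_add_sq hmeas.aestronglyMeasurable hbound
  refine ⟨∫ k in Set.Ioi (0 : ℝ), (g k - 1 / ((e + k) * (1 + k))),
    norm_integral_le_of_norm_le integrableOn_one_div_one_add_sq hbound, ?_⟩
  rw [← hval, ← integral_add hint hdiff, ← integral_const_mul, bindingS]
  congr 2
  ext k
  simp only [hg]
  ring

/-- As `e → 0⁺`, `S(e)` is asymptotic to `(4/(3π)) e ln(1/e)`; this small-`e`
asymptotics recovers Bethe's formula for the Lamb shift for small `Zα`. -/
theorem bindingS_asymptotics_zero :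
    Tendsto (fun e => bindingS e / (e * Real.log (1 / e)))
      (nhdsWithin 0 (Set.Ioi 0)) (nhds (4 / (3 * π))) := by
  obtain ⟨C, hC⟩ := exists_bindingS_eq_log_add_bounded
  choose! r hr hS using hC
  have hlog : Tendsto (fun e : ℝ => Real.log (1 / e)) (nhdsWithin 0 (Set.Ioi 0)) atTop := by
    simp only [one_div]
    exact Real.tendsto_log_atTop.comp tendsto_inv_nhdsGT_zero
  have hmem : ∀ᶠ e : ℝ in nhdsWithin 0 (Set.Ioi 0), 0 < e ∧ e < 1 :=
    Ioo_mem_nhdsGT one_pos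
  have hrem : Tendsto (fun e => r e / Real.log (1 / e)) (nhdsWithin 0 (Set.Ioi 0)) (nhds 0) := by
    refine squeeze_zero_norm' ?_ (hlog.const_div_atTop C)
    filter_upwards [hmem, hlog.eventually_gt_atTop 0] with e he hpos
    rw [norm_div, Real.norm_of_nonneg hpos.le, Real.norm_eq_abs]
    gcongr
    exact hr e he.1 he.2
  have hmain : Tendsto (fun e : ℝ => 1 / (1 - e)) (nhdsWithin 0 (Set.Ioi 0)) (nhds 1) := by
    have h : ContinuousAt (fun e : ℝ => 1 / (1 - e)) 0 := by
      fun_prop (disch := norm_num)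
    simpa using h.tendsto.mono_left nhdsWithin_le_nhds
  have hlim := (hmain.add hrem).const_mul (4 / (3 * π))
  rw [add_zero, mul_one] at hlim
  refine hlim.congr' ?_
  filter_upwards [hmem, hlog.eventually_gt_atTop 0] with e he hpos
  have he0 : e ≠ 0 := he.1.ne'
  have hlog0 : Real.log (1 / e) ≠ 0 := hpos.ne'
  have hsub0 : 1 - e ≠ 0 := by linarith [he.2]
  rw [hS e he.1 he.2]
  generalize Real.log (1 / e) = L at *
  field_simp
end

section
/- For all m > 0, α > 0 and Λ > 0, there exists a unique m₀ > 0 satisfying the mass renormalization equation m = m₀ · ( 1 + α · (16/(3π)) · ( ln(1 + Λ/(2m₀)) − (3/4) · Λ(Λ + (4/3)m₀)/(Λ + 2m₀)² ) ). -/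
open Real

/-- A rational lower bound for `log (1 + u)` on the nonnegative half-line. -/
lemma rational_le_log_one_add {u : ℝ} (hu : 0 ≤ u) :
    u * (7 * u ^ 2 + 9 * u + 4) / (4 * (1 + u) ^ 3) ≤ log (1 + u) := by
  have hd : ∀ x : ℝ, 0 ≤ x → HasDerivAt
      (fun u : ℝ => log (1 + u) - u * (7 * u ^ 2 + 9 * u + 4) / (4 * (1 + u) ^ 3))
      (x * (1 + 2 * x ^ 2) / (2 * (1 + x) ^ 4)) x := by
    intro x hx
    have h1 : HasDerivAt (fun u : ℝ => 1 + u) 1 x := (hasDerivAt_id x).const_add 1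
    have hne : 1 + x ≠ 0 := by positivity
    have h2 := (hasDerivAt_id x).mul
      (((((hasDerivAt_id x).pow 2).const_mul 7).add ((hasDerivAt_id x).const_mul 9)).add_const 4)
    have h3 := (h1.pow 3).const_mul 4
    have h4 := (h1.log hne).sub (h2.div h3 (by simp [hne]))
    refine h4.congr_deriv ?_
    simp
    field_simp
    ring
  have hmono := monotoneOn_of_hasDerivWithinAt_nonneg (convex_Ici (0 : ℝ))
    (fun x hx => (hd x hx).continuousAt.continuousWithinAt)
    (fun x hx => (hd x (interior_subset hx)).hasDerivWithinAt)
    (fun x hx => by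
      have : 0 ≤ x := interior_subset hx
      positivity)
  have := hmono (Set.mem_Ici.2 le_rfl) (Set.mem_Ici.2 hu) hu
  simpa using this

/-- The coefficient of the coupling in the mass renormalization equation, written so that it
extends continuously to bare mass zero. -/
noncomputable def massCorrection (Λ x : ℝ) : ℝ :=
  x * log (2 * x + Λ) - x * log (2 * x) -
    3 / 4 * Λ * (x * (Λ + 4 / 3 * x) / (Λ + 2 * x) ^ 2)

lemma massCorrection_zero (Λ : ℝ) : massCorrection Λ 0 = 0 := by
  simp [massCorrection]

lemma massCorrection_eq {Λ x : ℝ} (hΛ : 0 < Λ) (hx : 0 < x) :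
    massCorrection Λ x = x * (log (1 + Λ / (2 * x)) -
      3 / 4 * (Λ * (Λ + (4 / 3) * x) / (Λ + 2 * x) ^ 2)) := by
  have h : 1 + Λ / (2 * x) = (2 * x + Λ) / (2 * x) := by field_simp
  rw [h, log_div (by positivity) (by positivity), massCorrection]
  ring

lemma continuousOn_massCorrection {Λ : ℝ} (hΛ : 0 < Λ) :
    ContinuousOn (massCorrection Λ) (Set.Ici 0) := by
  have h1 : ContinuousOn (fun x : ℝ => x * log (2 * x + Λ)) (Set.Ici 0) := by
    refine continuousOn_id.mul (ContinuousOn.log (by fun_prop) fun x hx => ?_)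
    have : (0 : ℝ) ≤ x := hx
    positivity
  have h2 : Continuous (fun x : ℝ => x * log (2 * x)) := by
    have h : Continuous (fun x : ℝ => 1 / 2 * ((2 * x) * log (2 * x))) :=
      (continuous_mul_log.comp (continuous_const.mul continuous_id)).const_mul (1 / 2)
    convert h using 2
    ring
  have h3 : ContinuousOn (fun x : ℝ => x * (Λ + 4 / 3 * x) / (Λ + 2 * x) ^ 2) (Set.Ici 0) := by
    refine ContinuousOn.div (by fun_prop) (by fun_prop) fun x hx => ?_
    have : (0 : ℝ) ≤ x := hx
    positivity
  exact (h1.sub h2.continuousOn).sub (continuousOn_const.mul h3)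

lemma hasDerivAt_massCorrection {Λ x : ℝ} (hΛ : 0 < Λ) (hx : 0 < x) :
    HasDerivAt (massCorrection Λ)
      (log (1 + Λ / (2 * x)) - Λ / (2 * x) * (7 * (Λ / (2 * x)) ^ 2 + 9 * (Λ / (2 * x)) + 4) /
        (4 * (1 + Λ / (2 * x)) ^ 3)) x := by
  have hid := hasDerivAt_id x
  have h2x : HasDerivAt (fun y : ℝ => 2 * y) 2 x := by simpa using hid.const_mul 2
  have h1 := hid.mul ((h2x.add_const Λ).log (by positivity))
  have h2 := hid.mul (h2x.log (by positivity))
  have h3 := ((hid.mul ((hid.const_mul (4 / 3)).const_add Λ)).div ((h2x.const_add Λ).pow 2)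
    (by simp; positivity)).const_mul (3 / 4 * Λ)
  have h : 1 + Λ / (2 * x) = (2 * x + Λ) / (2 * x) := by field_simp
  refine ((h1.sub h2).sub h3).congr_deriv ?_
  rw [h, log_div (by positivity) (by positivity)]
  simp
  have e : Λ + 2 * x = 2 * x + Λ := add_comm _ _
  rw [e]
  have : 2 * x + Λ ≠ 0 := by positivity
  field_simp
  ring

lemma monotoneOn_massCorrection {Λ : ℝ} (hΛ : 0 < Λ) :
    MonotoneOn (massCorrection Λ) (Set.Ici 0) := by
  refine monotoneOn_of_hasDerivWithinAt_nonneg (convex_Ici 0) (continuousOn_massCorrection hΛ)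
    (fun x hx => (hasDerivAt_massCorrection hΛ (by simpa using hx)).hasDerivWithinAt) fun x hx => ?_
  have hx : 0 < x := by simpa using hx
  exact sub_nonneg.2 (rational_le_log_one_add (by positivity))

/-- For all positive physical mass `m`, coupling `α`, and cut-off `Λ` there is a unique
positive bare mass `m₀` solving the mass renormalization equation of the
Pauli–Fierz model. -/
theorem mass_renormalization_unique (m α Λ : ℝ) (hm : 0 < m) (hα : 0 < α) (hΛ : 0 < Λ) :
    ∃! m₀ : ℝ, 0 < m₀ ∧
      m = m₀ * (1 + α * (16 / (3 * π)) *
        (Real.log (1 + Λ / (2 * m₀)) -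
          3 / 4 * (Λ * (Λ + (4 / 3) * m₀) / (Λ + 2 * m₀) ^ 2))) := by
  set c : ℝ := α * (16 / (3 * π)) with hc
  have hc0 : 0 < c := by positivity
  have hrw : ∀ x : ℝ, 0 < x → x * (1 + c * (log (1 + Λ / (2 * x)) -
      3 / 4 * (Λ * (Λ + (4 / 3) * x) / (Λ + 2 * x) ^ 2))) = x + c * massCorrection Λ x := by
    intro x hx
    rw [massCorrection_eq hΛ hx]
    ring
  have hmono : StrictMonoOn (fun x => x + c * massCorrection Λ x) (Set.Ici 0) := by
    intro x hx y hy hxy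
    exact add_lt_add_of_lt_of_le hxy
      (mul_le_mul_of_nonneg_left (monotoneOn_massCorrection hΛ hx hy hxy.le) hc0.le)
  have hcont : ContinuousOn (fun x => x + c * massCorrection Λ x) (Set.Icc 0 m) :=
    continuousOn_id.add (continuousOn_const.mul
      ((continuousOn_massCorrection hΛ).mono Set.Icc_subset_Ici_self))
  have hnonneg : 0 ≤ massCorrection Λ m := by
    simpa [massCorrection_zero] using
      monotoneOn_massCorrection hΛ (Set.mem_Ici.2 le_rfl) (Set.mem_Ici.2 hm.le) hm.le
  obtain ⟨x, hx, hxm⟩ := intermediate_value_Icc hm.le hcont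
    (show m ∈ Set.Icc _ _ from
      ⟨by simpa [massCorrection_zero] using hm.le, le_add_of_nonneg_right (by positivity)⟩)
  have hx0 : 0 < x := by
    refine lt_of_le_of_ne hx.1 fun h => hm.ne ?_
    subst h
    simpa [massCorrection_zero] using hxm
  refine ⟨x, ⟨hx0, by rw [hrw x hx0]; exact hxm.symm⟩, ?_⟩
  rintro y ⟨hy0, hym⟩
  rw [hrw y hy0] at hym
  exact hmono.injOn (Set.mem_Ici.2 hy0.le) (Set.mem_Ici.2 hx0.le) (hym.symm.trans hxm.symm)
end

section
/- Let m, β, Z > 0, set λ = mβZ, e₀ = −(m/2)(βZ)², and let φ₀(x) = (λ³/π)^{1/2} e^{−λ|x|}. For j = 1, 2, 3 let ψⱼ = ∂ⱼφ₀, i.e. ψⱼ(x) = −λ (xⱼ/|x|) φ₀(x) for x ≠ 0, with gradient ∇ψⱼ computed pointwise on ℝ³∖{0}. Then each of the functions |∇ψⱼ|²/(2m), (βZ/|x|)ψⱼ², and ψⱼ² is Lebesgue integrable on ℝ³, and Σ_{j=1}^{3} ∫_{ℝ³} ( (1/(2m)) |∇ψⱼ(x)|² − (βZ/|x|) ψⱼ(x)²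 − e₀ ψⱼ(x)² ) dx = 2πβZ · φ₀(0)² = 2 m³ (βZ)⁴. -/
open MeasureTheory Real

/-- The hydrogen ground state wave function `φ₀(x) = (λ³/π)^{1/2} e^{−λ|x|}`. -/
noncomputable def hydrogenGS (lam : ℝ) (x : EuclideanSpace ℝ (Fin 3)) : ℝ :=
  Real.sqrt (lam ^ 3 / π) * Real.exp (-lam * ‖x‖)

/-- `ψⱼ = ∂ⱼφ₀, i.e. ψⱼ(x) = −λ (xⱼ/|x|) φ₀(x)`, the `j`-th partial derivative of the
hydrogen ground state. -/
noncomputable def hydrogenGSDeriv (lam : ℝ) (j : Fin 3) (x : EuclideanSpace ℝ (Fin 3)) :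
    ℝ :=
  -lam * (x j / ‖x‖) * hydrogenGS lam x

/-- The Fréchet derivative of the norm away from the origin. -/
lemma hasFDerivAt_norm_of_ne_zero {E : Type*} [NormedAddCommGroup E] [InnerProductSpace ℝ E]
    {x : E} (hx : x ≠ 0) : HasFDerivAt (fun y : E => ‖y‖) (‖x‖⁻¹ • innerSL ℝ x) x := by
  have h := (hasStrictFDerivAt_norm_sq x).hasFDerivAt.sqrt (by positivity)
  simp only [Real.sqrt_sq (norm_nonneg _)] at h
  convert! h using 1
  ext y
  simp only [smul_apply, innerSL_apply_apply, smul_eq_mul, nsmul_eq_mul, Nat.cast_ofNat]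
  field_simp

/-- The gradient of `ψⱼ` away from the origin. -/
lemma hasGradientAt_hydrogenGSDeriv (lam : ℝ) (j : Fin 3) {x : EuclideanSpace ℝ (Fin 3)}
    (hx : x ≠ 0) :
    HasGradientAt (hydrogenGSDeriv lam j)
      ((-lam * hydrogenGS lam x) • (‖x‖⁻¹ • EuclideanSpace.single j (1 : ℝ) -
        (x j * (1 / ‖x‖ ^ 3 + lam / ‖x‖ ^ 2)) • x)) x := by
  have hr : ‖x‖ ≠ 0 := norm_ne_zero_iff.2 hx
  have hn := hasFDerivAt_norm_of_ne_zero hx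
  have hc : HasFDerivAt (fun y : EuclideanSpace ℝ (Fin 3) => y j)
      (EuclideanSpace.proj j : EuclideanSpace ℝ (Fin 3) →L[ℝ] ℝ) x :=
    (EuclideanSpace.proj j : EuclideanSpace ℝ (Fin 3) →L[ℝ] ℝ).hasFDerivAt
  have hi := (hasDerivAt_inv hr).comp_hasFDerivAt x hn
  have he := ((hn.const_mul (-lam)).exp).const_mul (√(lam ^ 3 / π))
  have h := ((hc.mul hi).const_mul (-lam)).mul he
  rw [hasGradientAt_iff_hasFDerivAt]
  convert! h using 1
  ext y
  simp only [InnerProductSpace.toDual_apply_apply, inner_smul_left, inner_sub_left,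
    EuclideanSpace.inner_single_left, smul_apply, add_apply, innerSL_apply_apply, smul_eq_mul,
    PiLp.proj_apply, Function.comp_apply, Pi.mul_apply, hydrogenGS, RCLike.conj_to_real,
    map_one, one_mul]
  field_simp
  ring

/-- The squared length of `∇ψⱼ` away from the origin. -/
lemma norm_sq_gradient_hydrogenGSDeriv (lam : ℝ) (j : Fin 3) {x : EuclideanSpace ℝ (Fin 3)}
    (hx : x ≠ 0) :
    ‖gradient (hydrogenGSDeriv lam j) x‖ ^ 2 = lam ^ 2 * hydrogenGS lam x ^ 2 *
      (1 / ‖x‖ ^ 2 - (x j / ‖x‖) ^ 2 / ‖x‖ ^ 2 + lam ^ 2 * (x j / ‖x‖) ^ 2) := by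
  have hr : ‖x‖ ≠ 0 := norm_ne_zero_iff.2 hx
  rw [(hasGradientAt_hydrogenGSDeriv lam j hx).gradient, norm_smul, mul_pow, norm_sub_sq_real,
    norm_smul, norm_smul, inner_smul_left, inner_smul_right, EuclideanSpace.inner_single_left]
  simp only [mul_pow, Real.norm_eq_abs, sq_abs, RCLike.conj_to_real, PiLp.norm_single,
    map_one, one_mul, abs_one]
  field_simp
  ring

/-- Moments of an exponential with natural exponent, as an integral over the half-line. -/
lemma integral_pow_mul_exp_neg_mul_Ioi (n : ℕ) {b : ℝ} (hb : 0 < b) :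
    ∫ t in Set.Ioi (0 : ℝ), t ^ n * Real.exp (-(b * t)) = n.factorial / b ^ (n + 1) := by
  have h := Real.integral_rpow_mul_exp_neg_mul_Ioi (a := (n : ℝ) + 1) (by positivity) hb
  simp only [add_sub_cancel_right, Real.rpow_natCast, Real.Gamma_nat_eq_factorial] at h
  rw [h, ← Nat.cast_succ, Real.rpow_natCast]
  simp [div_eq_inv_mul]

/-- The radial function `|x|ⁿ⁻² e^{−b|x|}` is integrable on `ℝ³`. -/
lemma integrable_radial_exp (n : ℕ) {b : ℝ} (hb : 0 < b) :
    Integrable (fun x : EuclideanSpace ℝ (Fin 3) =>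
      ‖x‖ ^ n / ‖x‖ ^ 2 * Real.exp (-(b * ‖x‖))) volume := by
  refine (integrable_fun_norm_addHaar volume
    (f := fun r : ℝ => r ^ n / r ^ 2 * Real.exp (-(b * r)))).2 ?_
  have h : IntegrableOn (fun t : ℝ => t ^ n * Real.exp (-(b * t))) (Set.Ioi 0) :=
    .of_integral_ne_zero (by rw [integral_pow_mul_exp_neg_mul_Ioi n hb]; positivity)
  refine h.congr_fun (fun t (ht : 0 < t) => ?_) measurableSet_Ioi
  simp only [finrank_euclideanSpace, Fintype.card_fin, smul_eq_mul]
  field_simp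

/-- The integral over `ℝ³` of the radial function `|x|ⁿ⁻² e^{−b|x|}`. -/
lemma integral_radial_exp (n : ℕ) {b : ℝ} (hb : 0 < b) :
    ∫ x : EuclideanSpace ℝ (Fin 3), ‖x‖ ^ n / ‖x‖ ^ 2 * Real.exp (-(b * ‖x‖)) =
      4 * π * (n.factorial / b ^ (n + 1)) := by
  rw [integral_fun_norm_addHaar volume (fun r : ℝ => r ^ n / r ^ 2 * Real.exp (-(b * r))),
    ← integral_pow_mul_exp_neg_mul_Ioi n hb, Measure.real, EuclideanSpace.volume_ball_fin_three,
    setIntegral_congr_fun (g := fun t : ℝ => t ^ n * Real.exp (-(b * t))) measurableSet_Ioi]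
  · have : (0 : ℝ) ≤ π * 4 / 3 := by positivity
    simp only [finrank_euclideanSpace, Fintype.card_fin, smul_eq_mul, nsmul_eq_mul,
      ENNReal.ofReal_one, one_pow, one_mul, ENNReal.toReal_ofReal this]
    push_cast
    ring
  · intro t (ht : 0 < t)
    simp only [finrank_euclideanSpace, Fintype.card_fin, smul_eq_mul]
    field_simp

/-- The squared direction cosine `(xⱼ/|x|)²` times an integrable function is integrable. -/
lemma MeasureTheory.Integrable.sq_coord_div_norm_mul {f : EuclideanSpace ℝ (Fin 3) → ℝ}
    (hf : Integrable f volume) (j : Fin 3) :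
    Integrable (fun x => (x j / ‖x‖) ^ 2 * f x) volume := by
  refine hf.bdd_mul (c := 1) (Measurable.aestronglyMeasurable (by fun_prop)) (.of_forall fun x => ?_)
  have h : |x j / ‖x‖| ≤ 1 := by
    rw [abs_div, abs_norm]
    exact div_le_one_of_le₀ (PiLp.norm_apply_le x j) (norm_nonneg x)
  rw [Real.norm_eq_abs, abs_of_nonneg (sq_nonneg _), ← sq_abs]
  exact pow_le_one₀ (abs_nonneg _) h

/-- The square of the hydrogen ground state. -/
lemma hydrogenGS_sq {lam : ℝ} (hl : 0 < lam) (x : EuclideanSpace ℝ (Fin 3)) :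
    hydrogenGS lam x ^ 2 = lam ^ 3 / π * Real.exp (-(2 * lam * ‖x‖)) := by
  rw [hydrogenGS, mul_pow, Real.sq_sqrt (by positivity), ← Real.exp_nat_mul]
  congr 2
  push_cast
  ring

/-- The double-commutator computation
`Σⱼ ⟨pⱼφ₀ | (1/(2m))|p|² + V − e₀ | pⱼφ₀⟩ = 2π(βZ)|φ₀(0)|² = 2m³(βZ)⁴` used in the
lower bound on the renormalized binding energy. -/
theorem double_commutator_identity (m β Z : ℝ) (hm : 0 < m) (hβ : 0 < β) (hZ : 0 < Z) :
    (∀ j : Fin 3, Integrable (fun x : EuclideanSpace ℝ (Fin 3) =>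
      ‖gradient (hydrogenGSDeriv (m * β * Z) j) x‖ ^ 2 / (2 * m)) volume) ∧
    (∀ j : Fin 3, Integrable (fun x : EuclideanSpace ℝ (Fin 3) =>
      (β * Z / ‖x‖) * (hydrogenGSDeriv (m * β * Z) j x) ^ 2) volume) ∧
    (∀ j : Fin 3, Integrable (fun x : EuclideanSpace ℝ (Fin 3) =>
      (hydrogenGSDeriv (m * β * Z) j x) ^ 2) volume) ∧
    ∑ j : Fin 3, ∫ x : EuclideanSpace ℝ (Fin 3),
        ((1 / (2 * m)) * ‖gradient (hydrogenGSDeriv (m * β * Z) j) x‖ ^ 2 -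
          (β * Z / ‖x‖) * (hydrogenGSDeriv (m * β * Z) j x) ^ 2 -
          (-(m / 2) * (β * Z) ^ 2) * (hydrogenGSDeriv (m * β * Z) j x) ^ 2) =
      2 * π * β * Z * (hydrogenGS (m * β * Z) 0) ^ 2 ∧
    2 * π * β * Z * (hydrogenGS (m * β * Z) 0) ^ 2 = 2 * m ^ 3 * (β * Z) ^ 4 := by
  obtain ⟨lam, hlam⟩ : ∃ lam, lam = m * β * Z := ⟨_, rfl⟩
  rw [← hlam]
  have hl : 0 < lam := by rw [hlam]; positivity
  have hb : 0 < 2 * lam := by positivity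
  have hne : ∀ᵐ x : EuclideanSpace ℝ (Fin 3), x ≠ 0 := by
    simp [ae_iff]
  have hF := fun n : ℕ => integrable_radial_exp n hb
  have hP := fun (n : ℕ) (j : Fin 3) => (hF n).sq_coord_div_norm_mul j
  have h₁ : ∀ j : Fin 3, Integrable (fun x : EuclideanSpace ℝ (Fin 3) =>
      ‖gradient (hydrogenGSDeriv lam j) x‖ ^ 2 / (2 * m)) volume := fun j => by
    refine ((((hF 0).sub (hP 0 j)).add ((hP 2 j).const_mul (lam ^ 2))).const_mul
      (lam ^ 5 / π / (2 * m))).congr ?_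
    filter_upwards [hne] with x hx
    have hr : ‖x‖ ≠ 0 := norm_ne_zero_iff.2 hx
    simp only [Pi.add_apply, Pi.sub_apply]
    rw [norm_sq_gradient_hydrogenGSDeriv lam j hx, hydrogenGS_sq hl]
    field_simp
  have h₂ : ∀ j : Fin 3, Integrable (fun x : EuclideanSpace ℝ (Fin 3) =>
      (β * Z / ‖x‖) * (hydrogenGSDeriv lam j x) ^ 2) volume := fun j => by
    refine ((hP 1 j).const_mul (β * Z * (lam ^ 5 / π))).congr ?_
    filter_upwards [hne] with x hx
    have hr : ‖x‖ ≠ 0 := norm_ne_zero_iff.2 hx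
    rw [hydrogenGSDeriv, mul_pow, hydrogenGS_sq hl]
    field_simp
  have h₃ : ∀ j : Fin 3, Integrable (fun x : EuclideanSpace ℝ (Fin 3) =>
      (hydrogenGSDeriv lam j x) ^ 2) volume := fun j => by
    refine ((hP 2 j).const_mul (lam ^ 5 / π)).congr ?_
    filter_upwards [hne] with x hx
    have hr : ‖x‖ ≠ 0 := norm_ne_zero_iff.2 hx
    rw [hydrogenGSDeriv, mul_pow, hydrogenGS_sq hl]
    field_simp
  have h₀ : 2 * π * β * Z * (hydrogenGS lam 0) ^ 2 = 2 * m ^ 3 * (β * Z) ^ 4 := by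
    rw [hydrogenGS_sq hl, hlam, norm_zero, mul_zero, neg_zero, Real.exp_zero]
    field_simp
  refine ⟨h₁, h₂, h₃, ?_, h₀⟩
  rw [h₀, ← integral_finsetSum]
  · have hsum : (fun x : EuclideanSpace ℝ (Fin 3) => ∑ j : Fin 3,
        ((1 / (2 * m)) * ‖gradient (hydrogenGSDeriv lam j) x‖ ^ 2 -
          (β * Z / ‖x‖) * (hydrogenGSDeriv lam j x) ^ 2 -
          (-(m / 2) * (β * Z) ^ 2) * (hydrogenGSDeriv lam j x) ^ 2)) =ᵐ[volume]
        fun x => lam ^ 5 / (π * m) * (‖x‖ ^ 0 / ‖x‖ ^ 2 * Real.exp (-(2 * lam * ‖x‖)) -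
          lam * (‖x‖ ^ 1 / ‖x‖ ^ 2 * Real.exp (-(2 * lam * ‖x‖))) +
          lam ^ 2 * (‖x‖ ^ 2 / ‖x‖ ^ 2 * Real.exp (-(2 * lam * ‖x‖)))) := by
      filter_upwards [hne] with x hx
      have hr : ‖x‖ ≠ 0 := norm_ne_zero_iff.2 hx
      have hcos : ∑ j : Fin 3, (x j / ‖x‖) ^ 2 = 1 := by
        simp only [div_pow, ← Finset.sum_div, ← EuclideanSpace.real_norm_sq_eq]
        exact div_self (pow_ne_zero 2 hr)
      have hterm : ∀ j : Fin 3, (1 / (2 * m)) * ‖gradient (hydrogenGSDeriv lam j) x‖ ^ 2 -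
          (β * Z / ‖x‖) * (hydrogenGSDeriv lam j x) ^ 2 -
          (-(m / 2) * (β * Z) ^ 2) * (hydrogenGSDeriv lam j x) ^ 2 =
          lam ^ 5 / π * Real.exp (-(2 * lam * ‖x‖)) * (1 / (2 * m) / ‖x‖ ^ 2 +
            (x j / ‖x‖) ^ 2 * (lam ^ 2 / m - 1 / (2 * m) / ‖x‖ ^ 2 - lam / m / ‖x‖)) := by
        intro j
        have hβZ : β * Z = lam / m := by rw [hlam]; field_simp
        rw [norm_sq_gradient_hydrogenGSDeriv lam j hx, hydrogenGSDeriv, mul_pow, mul_pow,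
          hydrogenGS_sq hl, hβZ]
        field_simp
        ring
      simp only [hterm]
      rw [← Finset.mul_sum, Finset.sum_add_distrib, ← Finset.sum_mul, hcos]
      simp only [Finset.sum_const, Finset.card_univ, Fintype.card_fin, nsmul_eq_mul]
      push_cast
      field_simp
      ring
    have hdiff : Integrable (fun x : EuclideanSpace ℝ (Fin 3) =>
        ‖x‖ ^ 0 / ‖x‖ ^ 2 * Real.exp (-(2 * lam * ‖x‖)) -
          lam * (‖x‖ ^ 1 / ‖x‖ ^ 2 * Real.exp (-(2 * lam * ‖x‖)))) volume :=
      (hF 0).sub ((hF 1).const_mul lam)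
    rw [integral_congr_ae hsum, integral_const_mul,
      integral_add hdiff ((hF 2).const_mul _),
      integral_sub (hF 0) ((hF 1).const_mul _), integral_const_mul, integral_const_mul,
      integral_radial_exp 0 hb, integral_radial_exp 1 hb, integral_radial_exp 2 hb]
    simp only [Nat.factorial]
    push_cast
    rw [hlam]
    field_simp
    ring
  · intro j _
    refine (((h₁ j).sub (h₂ j)).sub ((h₃ j).const_mul (-(m / 2) * (β * Z) ^ 2))).congr
      (.of_forall fun x => ?_)
    simp only [Pi.sub_apply]
    ring
end

section
/- Let ρ, F : ℝ³ → [0, ∞) be measurable functions and let δ > 0. Then, as an inequality of extended nonnegative reals, ∫_{ℝ³}∫_{ℝ³} √(ρ(k)ρ(q)) · F(k)F(q) / ( |k| + |q| + δ ) dk dq ≤ ( ∫_{ℝ³} ρ(k)|k| dk ) · ( ∫_{ℝ³}∫_{ℝ³} F(k)² F(q)² / ( |k| |q| (|k| + |q| + δ)² ) dk dq )^{1/2}. -/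
open MeasureTheory Real ENNReal

/-- The double Cauchy–Schwarz estimate bounding the off-diagonal term `II_n` in the
proof of the dispersion relation: for nonnegative measurable `ρ`, `F` and `δ > 0`,
`∫∫ √(ρ(k)ρ(q)) F(k)F(q)/(|k|+|q|+δ) ≤ (∫ ρ(k)|k|) (∫∫ F(k)²F(q)²/(|k||q|(|k|+|q|+δ)²))^{1/2}`. -/
theorem offdiagonal_schwarz_bound (ρ F : EuclideanSpace ℝ (Fin 3) → ℝ)
    (hρ : Measurable ρ) (hF : Measurable F) (hρ0 : ∀ k, 0 ≤ ρ k) (hF0 : ∀ k, 0 ≤ F k)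
    (δ : ℝ) (hδ : 0 < δ) :
    ∫⁻ k : EuclideanSpace ℝ (Fin 3), ∫⁻ q : EuclideanSpace ℝ (Fin 3),
        ENNReal.ofReal (Real.sqrt (ρ k * ρ q) * (F k * F q) / (‖k‖ + ‖q‖ + δ)) ≤
      (∫⁻ k : EuclideanSpace ℝ (Fin 3), ENNReal.ofReal (ρ k * ‖k‖)) *
        (∫⁻ k : EuclideanSpace ℝ (Fin 3), ∫⁻ q : EuclideanSpace ℝ (Fin 3),
          ENNReal.ofReal (F k ^ 2 * F q ^ 2 / (‖k‖ * ‖q‖ * (‖k‖ + ‖q‖ + δ) ^ 2)))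
          ^ (1 / 2 : ℝ) := by
  set a : EuclideanSpace ℝ (Fin 3) × EuclideanSpace ℝ (Fin 3) → ℝ≥0∞ := fun z =>
    ENNReal.ofReal (√((ρ z.1 * ‖z.1‖) * (ρ z.2 * ‖z.2‖))) with ha
  set b : EuclideanSpace ℝ (Fin 3) × EuclideanSpace ℝ (Fin 3) → ℝ≥0∞ := fun z =>
    ENNReal.ofReal (F z.1 * F z.2 / (√(‖z.1‖ * ‖z.2‖) * (‖z.1‖ + ‖z.2‖ + δ))) with hb
  have ham : Measurable a := by fun_prop
  have hbm : Measurable b := by fun_prop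
  have ha2 (z : EuclideanSpace ℝ (Fin 3) × EuclideanSpace ℝ (Fin 3)) : a z ^ (2 : ℝ) =
      ENNReal.ofReal (ρ z.1 * ‖z.1‖) * ENNReal.ofReal (ρ z.2 * ‖z.2‖) := by
    have h1 := mul_nonneg (hρ0 z.1) (norm_nonneg z.1)
    have h2 := mul_nonneg (hρ0 z.2) (norm_nonneg z.2)
    rw [ENNReal.rpow_two, ha, ← ENNReal.ofReal_pow (Real.sqrt_nonneg _),
      Real.sq_sqrt (mul_nonneg h1 h2), ENNReal.ofReal_mul h1]
  have hb2 (z : EuclideanSpace ℝ (Fin 3) × EuclideanSpace ℝ (Fin 3)) : b z ^ (2 : ℝ) = ENNReal.ofReal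
      (F z.1 ^ 2 * F z.2 ^ 2 / (‖z.1‖ * ‖z.2‖ * (‖z.1‖ + ‖z.2‖ + δ) ^ 2)) := by
    have h1 := hF0 z.1
    have h2 := hF0 z.2
    rw [ENNReal.rpow_two, hb, ← ENNReal.ofReal_pow (by positivity), div_pow, mul_pow, mul_pow,
      Real.sq_sqrt (by positivity)]
  have hne : ∀ᵐ k : EuclideanSpace ℝ (Fin 3), k ≠ 0 := by simp [ae_iff]
  have hab : ∫⁻ k : EuclideanSpace ℝ (Fin 3), ∫⁻ q : EuclideanSpace ℝ (Fin 3),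
      ENNReal.ofReal (√(ρ k * ρ q) * (F k * F q) / (‖k‖ + ‖q‖ + δ)) =
      ∫⁻ k : EuclideanSpace ℝ (Fin 3), ∫⁻ q : EuclideanSpace ℝ (Fin 3), (a * b) (k, q) := by
    refine lintegral_congr_ae ?_
    filter_upwards [hne] with k hk
    refine lintegral_congr_ae ?_
    filter_upwards [hne] with q hq
    have hs : 0 < √(‖k‖ * ‖q‖) :=
      Real.sqrt_pos.2 (mul_pos (norm_pos_iff.2 hk) (norm_pos_iff.2 hq))
    have hd : 0 < ‖k‖ + ‖q‖ + δ := by positivity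
    rw [Pi.mul_apply, ha, hb, ← ENNReal.ofReal_mul (Real.sqrt_nonneg _)]
    congr 1
    rw [mul_mul_mul_comm (ρ k), Real.sqrt_mul (mul_nonneg (hρ0 k) (hρ0 q))]
    field_simp
  have key := ENNReal.lintegral_mul_le_Lp_mul_Lq ((volume : Measure (EuclideanSpace ℝ (Fin 3))).prod volume)
    Real.HolderConjugate.two_two ham.aemeasurable hbm.aemeasurable
  rw [lintegral_prod _ (ham.mul hbm).aemeasurable,
    lintegral_prod _ (ham.pow_const _).aemeasurable,
    lintegral_prod _ (hbm.pow_const _).aemeasurable] at key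
  simp only [ha2, hb2] at key
  rw [lintegral_lintegral_mul (by fun_prop) (by fun_prop), ← pow_two, ← ENNReal.rpow_two,
    ← ENNReal.rpow_mul, mul_one_div_cancel two_ne_zero, ENNReal.rpow_one] at key
  exact hab.trans_le key
end
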